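/- arXiv:2205.11517 — 3 statements merged into one kernel-verified Lean document; each statement's English description precedes it below -/
import Mathlib

section
/- For all real y, all naturals N ≥ 1 and n, the Quasi-Hermite polynomials satisfy the multiplicative recurrence (1 + (y/N) • D²)(H_{n+1}(x,y;N)) = (1 + (y/N) • D²)(X · Hₙ(x,y;N)) + 2y • D(Hₙ(x,y;N)). -/
open Polynomial

/-- Formal differentiation on `ℝ[X]`, as a linear endomorphism. -/
noncomputable def D : Module.End ℝ (Polynomial ℝ) := Polynomial.derivative

/-- The Quasi-Hermite polynomial `Hₙ(x,y;N) := ((1 + (y/N) • D²)^N)(Xⁿ)`. -/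
noncomputable def QH (y : ℝ) (N n : ℕ) : Polynomial ℝ :=
  (((1 : Module.End ℝ (Polynomial ℝ)) + (y / (N : ℝ)) • D ^ 2) ^ N) ((Polynomial.X : Polynomial ℝ) ^ n)

lemma D_comp_one_add_smul_D_sq (c : ℝ) (p : ℝ[X]) :
    ((1 : Module.End ℝ ℝ[X]) + c • D ^ 2) (D p) =
      D (((1 : Module.End ℝ ℝ[X]) + c • D ^ 2) p) := by
  simp [pow_two]

lemma one_add_smul_D_sq_X_mul (c : ℝ) (p : ℝ[X]) :
    ((1 : Module.End ℝ ℝ[X]) + c • D ^ 2) (X * p) =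
      X * ((1 : Module.End ℝ ℝ[X]) + c • D ^ 2) p + (2 * c) • D p := by
  simp only [D, pow_two, LinearMap.add_apply, Module.End.one_apply, LinearMap.smul_apply,
    Module.End.mul_apply, derivative_mul, derivative_X, derivative_add, one_mul,
    smul_eq_C_mul, C_mul, map_ofNat]
  ring

/-- Commutation of powers of `1 + c • D ^ 2` with multiplication by `X`, in a form that avoids
natural-number subtraction. -/
lemma one_add_smul_D_sq_pow_X_mul (c : ℝ) (N : ℕ) (p : ℝ[X]) :
    ((1 : Module.End ℝ ℝ[X]) + c • D ^ 2) ((((1 : Module.End ℝ ℝ[X]) + c • D ^ 2) ^ N) (X * p)) =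
      ((1 : Module.End ℝ ℝ[X]) + c • D ^ 2) (X * (((1 : Module.End ℝ ℝ[X]) + c • D ^ 2) ^ N) p) +
        (2 * (N * c)) • D ((((1 : Module.End ℝ ℝ[X]) + c • D ^ 2) ^ N) p) := by
  induction N with
  | zero => simp
  | succ N ih =>
    simp only [pow_succ' _ N, Module.End.mul_apply, ih]
    rw [one_add_smul_D_sq_X_mul c ((((1 : Module.End ℝ ℝ[X]) + c • D ^ 2) ^ N) p),
      map_add, map_add, map_smul, map_smul, D_comp_one_add_smul_D_sq, add_assoc, ← add_smul]
    congr 2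
    push_cast
    ring

/-- Multiplicative recurrence
`(1 + (y/N)•D²)(H_{n+1}) = (1 + (y/N)•D²)(X·Hₙ) + 2y • D(Hₙ)`. -/
theorem quasi_hermite_mult_recurrence (y : ℝ) (N n : ℕ) (hN : 1 ≤ N) :
    ((1 : Module.End ℝ (Polynomial ℝ)) + (y / (N : ℝ)) • D ^ 2) (QH y N (n + 1)) =
      ((1 : Module.End ℝ (Polynomial ℝ)) + (y / (N : ℝ)) • D ^ 2) (Polynomial.X * QH y N n)
        + (2 * y) • D (QH y N n) := by
  have hc : (N : ℝ) * (y / N) = y := mul_div_cancel₀ y (by positivity)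
  have h := one_add_smul_D_sq_pow_X_mul (y / N) N (X ^ n)
  rwa [hc, ← pow_succ' X n] at h
end

section
/- For all real y, all naturals N ≥ 1 and n, the Quasi-Binomial polynomial z = Hₙ⁽¹⁾(x,y;N) satisfies the second-order differential equation (y/N) • X·D²z + ((X + y·1) - ((n-1)y/N)·1)·Dz = n • z as an identity in ℝ[X] (i.e. (y/N)x z'' + (x + y - (n-1)y/N) z' = n z). -/
open Polynomial

/-- The Quasi-Binomial polynomial `Hₙ⁽¹⁾(x,y;N) := ((1 + (y/N) • D)^N)(Xⁿ)`. -/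
noncomputable def QB (y : ℝ) (N n : ℕ) : Polynomial ℝ :=
  (((1 : Module.End ℝ (Polynomial ℝ)) + (y / (N : ℝ)) • D) ^ N) ((Polynomial.X : Polynomial ℝ) ^ n)

/-- The operator `1 + a D` commutes with differentiation, and so do its powers. -/
theorem one_add_smul_D_pow_apply_D (a : ℝ) (m : ℕ) (p : Polynomial ℝ) :
    ((1 + a • D) ^ m) (D p) = D (((1 + a • D) ^ m) p) := by
  have h : Commute ((1 + a • D) ^ m) D :=
    ((Commute.one_left D).add_left ((Commute.refl D).smul_left a)).pow_left m
  exact LinearMap.congr_fun h.eq p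

theorem D_X_mul (p : Polynomial ℝ) : D (X * p) = p + X * D p := by
  simp [D, derivative_mul]

/-- Commutation of a power of `1 + a D` with multiplication by `X`. -/
theorem one_add_smul_D_pow_X_mul (a : ℝ) (m : ℕ) (p : Polynomial ℝ) :
    ((1 + a • D) ^ (m + 1)) (X * p) =
      X * ((1 + a • D) ^ (m + 1)) p + (((m : ℝ) + 1) * a) • ((1 + a • D) ^ m) p := by
  induction m generalizing p with
  | zero =>
    simp only [zero_add, pow_one, pow_zero, LinearMap.add_apply, LinearMap.smul_apply,
      Module.End.one_apply, D_X_mul, smul_eq_C_mul]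
    simp
    ring
  | succ m ih =>
    have key : ((1 : Module.End ℝ (Polynomial ℝ)) + a • D) (X * p) =
        X * ((1 : Module.End ℝ (Polynomial ℝ)) + a • D) p + a • p := by
      simp only [LinearMap.add_apply, LinearMap.smul_apply, Module.End.one_apply, D_X_mul,
        smul_eq_C_mul]
      ring
    rw [pow_succ _ (m + 1), Module.End.mul_apply, key, map_add, ih, map_smul,
      Module.End.mul_apply, ← Module.End.mul_apply ((1 + a • D) ^ m), ← pow_succ]
    push_cast
    module

theorem X_mul_D_X_pow (n : ℕ) :
    X * D ((X : Polynomial ℝ) ^ n) = (n : ℝ) • (X : Polynomial ℝ) ^ n := by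
  cases n with
  | zero => simp [D]
  | succ n =>
    simp only [D, derivative_X_pow, smul_eq_C_mul, Nat.add_sub_cancel]
    ring

/-- The second-order ODE satisfied by `z = Hₙ⁽¹⁾(x,y;N)`:
`(y/N) x z'' + (x + y - (n-1)y/N) z' = n z`. -/
theorem quasi_binomial_ode (y : ℝ) (N n : ℕ) (hN : 1 ≤ N) :
    (y / (N : ℝ)) • (Polynomial.X * (D ^ 2) (QB y N n)) +
      (Polynomial.X + Polynomial.C (y - ((n : ℝ) - 1) * y / (N : ℝ))) * D (QB y N n) =
      (n : ℝ) • QB y N n := by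
  obtain ⟨m, rfl⟩ : ∃ m, N = m + 1 := ⟨N - 1, by omega⟩
  have hm : ((m + 1 : ℕ) : ℝ) ≠ 0 := by positivity
  obtain ⟨a, rfl⟩ : ∃ a, y = ((m + 1 : ℕ) : ℝ) * a := ⟨y / ((m + 1 : ℕ) : ℝ), by field_simp⟩
  have hy : ((m + 1 : ℕ) : ℝ) * a / ((m + 1 : ℕ) : ℝ) = a := by field_simp
  have hc : ((m + 1 : ℕ) : ℝ) * a - ((n : ℝ) - 1) * (((m + 1 : ℕ) : ℝ) * a) / ((m + 1 : ℕ) : ℝ) =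
      ((m : ℝ) + 1) * a - ((n : ℝ) - 1) * a := by
    rw [mul_div_assoc, hy]; push_cast; rfl
  rw [hc, QB, hy]
  set w := ((1 + a • D) ^ m) ((X : Polynomial ℝ) ^ n) with hw
  set z := ((1 + a • D) ^ (m + 1)) ((X : Polynomial ℝ) ^ n) with hz
  have hzw : z = w + a • D w := by
    rw [hz, pow_succ', Module.End.mul_apply, ← hw]; simp
  have first_order : (n : ℝ) • z = X * D z + (((m : ℝ) + 1) * a) • D w := by
    rw [hz, ← map_smul, ← X_mul_D_X_pow, one_add_smul_D_pow_X_mul, one_add_smul_D_pow_apply_D,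
      one_add_smul_D_pow_apply_D]
  have hDz : D z = D w + a • D (D w) := by
    rw [hzw, map_add, map_smul]
  have second_order := congrArg D first_order
  rw [map_smul, map_add, D_X_mul, map_smul] at second_order
  rw [pow_two, Module.End.mul_apply]
  simp only [smul_eq_C_mul, C_add, C_sub, C_mul, C_1] at *
  linear_combination -first_order - C a * second_order + (C (m : ℝ) + 1) * C a * hDz
end

section
/- For every real y and natural N ≥ 1, define F(x,y;N) := (1/Γ(N)) ∫₀^∞ s^{N-1} e^{-s} · exp(-x²/(1 + 4|y|s/N)) / √(1 + 4|y|s/N) ds. Then for every fixed real x and y, F(x,y;N) tends to (1/√(1+4|y|)) · exp(-x²/(1+4|y|)) as N → ∞ along the naturals (the generalized Glaisher formula reduces to the ordinary Glaisher identity in the limit). -/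
open MeasureTheory

/-- The generalized Glaisher function
`F(x,y;N) := (1/Γ(N)) ∫₀^∞ s^{N-1} e^{-s} exp(-x²/(1+4|y|s/N)) / √(1+4|y|s/N) ds`. -/
noncomputable def F (x y : ℝ) (N : ℕ) : ℝ :=
  (1 / Real.Gamma (N : ℝ)) * ∫ s in Set.Ioi (0 : ℝ),
    s ^ (N - 1) * Real.exp (-s) *
      Real.exp (-x ^ 2 / (1 + 4 * |y| * s / (N : ℝ))) /
        Real.sqrt (1 + 4 * |y| * s / (N : ℝ))

theorem integrableOn_pow_mul_exp_neg (k : ℕ) :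
    IntegrableOn (fun s : ℝ => s ^ k * Real.exp (-s)) (Set.Ioi 0) := by
  refine (Real.GammaIntegral_convergent (s := (k : ℝ) + 1) (by positivity)).congr_fun ?_
    measurableSet_Ioi
  intro s _
  simp [mul_comm]

theorem integral_pow_mul_exp_neg (k : ℕ) :
    ∫ s in Set.Ioi (0 : ℝ), s ^ k * Real.exp (-s) = (k.factorial : ℝ) := by
  rw [← Real.Gamma_nat_eq_factorial, Real.Gamma_eq_integral (by positivity)]
  refine setIntegral_congr_fun measurableSet_Ioi fun s _ => ?_
  simp [mul_comm]

/-- The Gamma density of shape `n + 1` rescaled to mean one has variance `1 / (n + 1)`, stated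
together with the integrability of the quadratic weight `a + b (s / (n + 1) - 1) ^ 2`. -/
theorem integrableOn_and_integral_gamma_quadratic (n : ℕ) (a b : ℝ) :
    IntegrableOn (fun s : ℝ => s ^ n * Real.exp (-s) * (a + b * (s / (n + 1 : ℝ) - 1) ^ 2))
        (Set.Ioi 0) ∧
      ∫ s in Set.Ioi (0 : ℝ), s ^ n * Real.exp (-s) * (a + b * (s / (n + 1 : ℝ) - 1) ^ 2) =
        (n.factorial : ℝ) * (a + b / (n + 1)) := by
  have expand : (fun s : ℝ => s ^ n * Real.exp (-s) * (a + b * (s / (n + 1 : ℝ) - 1) ^ 2)) =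
      fun s => (a + b) * (s ^ n * Real.exp (-s)) +
        (-(2 * b / (n + 1))) * (s ^ (n + 1) * Real.exp (-s)) +
        b / (n + 1) ^ 2 * (s ^ (n + 2) * Real.exp (-s)) := by
    funext s
    field_simp
    ring
  have h₀ := (integrableOn_pow_mul_exp_neg n).const_mul (a + b)
  have h₁ := (integrableOn_pow_mul_exp_neg (n + 1)).const_mul (-(2 * b / (n + 1 : ℝ)))
  have h₂ := (integrableOn_pow_mul_exp_neg (n + 2)).const_mul (b / (n + 1 : ℝ) ^ 2)
  rw [expand]
  refine ⟨(h₀.add h₁).add h₂, ?_⟩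
  rw [integral_add (by exact h₀.add h₁) h₂, integral_add h₀ h₁]
  simp only [integral_const_mul, integral_pow_mul_exp_neg, Nat.factorial_succ]
  push_cast
  field_simp
  ring

/-- A bounded function continuous at a point deviates from its value there by at most `ε` plus a
multiple of the squared distance. -/
theorem exists_abs_sub_le_add_mul_sq {g : ℝ → ℝ} {M : ℝ} {c : ℝ} {t : Set ℝ} (hc : c ∈ t)
    (hM : ∀ u ∈ t, |g u| ≤ M) (hg : ContinuousAt g c) {ε : ℝ} (hε : 0 < ε) :
    ∃ C, ∀ u ∈ t, |g u - g c| ≤ ε + C * (u - c) ^ 2 := by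
  obtain ⟨δ, hδ, h⟩ := Metric.continuousAt_iff.1 hg ε hε
  have hM₀ : 0 ≤ M := (abs_nonneg _).trans (hM c hc)
  refine ⟨2 * M / δ ^ 2, fun u hu => ?_⟩
  rcases lt_or_ge |u - c| δ with hlt | hge
  · have := h (x := u) (by rwa [Real.dist_eq])
    rw [Real.dist_eq] at this
    have : 0 ≤ 2 * M / δ ^ 2 * (u - c) ^ 2 := by positivity
    linarith
  · have hsq : δ ^ 2 ≤ (u - c) ^ 2 := by
      rw [← sq_abs (u - c)]
      gcongr
    have : 2 * M ≤ 2 * M / δ ^ 2 * (u - c) ^ 2 := by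
      rw [div_mul_eq_mul_div, le_div_iff₀ (by positivity)]
      gcongr
    have := abs_sub (g u) (g c)
    linarith [hM u hu, hM c hc]

/-- Gamma averages of shape `n + 1`, rescaled to mean one, concentrate at `1`. -/
theorem tendsto_gamma_average {g : ℝ → ℝ} {M : ℝ} (hmeas : Measurable g)
    (hM : ∀ u ∈ Set.Ioi (0 : ℝ), |g u| ≤ M) (hg : ContinuousAt g 1) :
    Filter.Tendsto (fun n : ℕ => 1 / (n.factorial : ℝ) *
      ∫ s in Set.Ioi (0 : ℝ), s ^ n * Real.exp (-s) * g (s / (n + 1))) Filter.atTop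
      (nhds (g 1)) := by
  rw [Metric.tendsto_atTop']
  intro ε hε
  obtain ⟨C, hC⟩ := exists_abs_sub_le_add_mul_sq (Set.mem_Ioi.2 one_pos) hM hg (half_pos hε)
  have hlim : Filter.Tendsto (fun n : ℕ => ε / 2 + C / ((n : ℝ) + 1)) Filter.atTop
      (nhds (ε / 2)) := by
    simpa [div_eq_mul_inv] using
      (tendsto_one_div_add_atTop_nhds_zero_nat (𝕜 := ℝ)).const_mul C |>.const_add (ε / 2)
  obtain ⟨n₀, hn₀⟩ := Filter.eventually_atTop.1 (hlim.eventually_lt_const (half_lt_self hε))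
  refine ⟨n₀, fun n hn => lt_of_le_of_lt ?_ (hn₀ n hn.le)⟩
  have hfac : (0 : ℝ) < n.factorial := by positivity
  have hint : IntegrableOn (fun s : ℝ => s ^ n * Real.exp (-s) * g (s / (n + 1))) (Set.Ioi 0) := by
    refine ((integrableOn_pow_mul_exp_neg n).const_mul M).mono'
      (Measurable.aestronglyMeasurable (by fun_prop)) ?_
    filter_upwards [ae_restrict_mem measurableSet_Ioi] with s hs
    have hs₀ : (0 : ℝ) < s := hs
    rw [Real.norm_eq_abs, abs_mul, abs_of_pos (by positivity), mul_comm]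
    gcongr
    exact hM _ (Set.mem_Ioi.2 (by positivity))
  have hconst := (integrableOn_pow_mul_exp_neg n).mul_const (g 1)
  obtain ⟨hqint, hq⟩ := integrableOn_and_integral_gamma_quadratic n (ε / 2) C
  have hbound := norm_integral_le_of_norm_le hqint
    (f := fun s : ℝ => s ^ n * Real.exp (-s) * g (s / (n + 1)) - s ^ n * Real.exp (-s) * g 1) (by
      filter_upwards [ae_restrict_mem measurableSet_Ioi] with s hs
      have hs₀ : (0 : ℝ) < s := hs
      rw [← mul_sub, Real.norm_eq_abs, abs_mul, abs_of_pos (by positivity)]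
      gcongr
      exact hC _ (Set.mem_Ioi.2 (by positivity)))
  rw [integral_sub hint hconst, integral_mul_const, integral_pow_mul_exp_neg, hq,
    Real.norm_eq_abs] at hbound
  rw [Real.dist_eq]
  have hfactor : ∀ I : ℝ, 1 / (n.factorial : ℝ) * I - g 1 =
      1 / (n.factorial : ℝ) * (I - n.factorial * g 1) := fun I => by field_simp
  rw [hfactor, abs_mul, abs_of_pos (by positivity), one_div_mul_eq_div, div_le_iff₀ hfac,
    mul_comm _ (n.factorial : ℝ)]
  exact hbound

/-- The generalized Glaisher formula reduces to the ordinary Glaisher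
identity in the limit: `F(x,y;N) → (1/√(1+4|y|)) exp(-x²/(1+4|y|))` as `N → ∞`. -/
theorem glaisher_limit (x y : ℝ) :
    Filter.Tendsto (fun N : ℕ => F x y N) Filter.atTop
      (nhds ((1 / Real.sqrt (1 + 4 * |y|)) * Real.exp (-x ^ 2 / (1 + 4 * |y|)))) := by
  set g : ℝ → ℝ := fun u => Real.exp (-x ^ 2 / (1 + 4 * |y| * u)) / Real.sqrt (1 + 4 * |y| * u)
    with hg_def
  have hmeas : Measurable g := by fun_prop
  have hbound : ∀ u ∈ Set.Ioi (0 : ℝ), |g u| ≤ 1 := by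
    intro u hu
    have hu₀ : (0 : ℝ) < u := hu
    have hden : 1 ≤ 1 + 4 * |y| * u := le_add_of_nonneg_right (by positivity)
    rw [abs_of_nonneg (by positivity)]
    refine div_le_one_of_le₀ ?_ (Real.sqrt_nonneg _)
    refine le_trans (Real.exp_le_one_iff.2 ?_) (Real.one_le_sqrt.2 hden)
    exact div_nonpos_of_nonpos_of_nonneg (neg_nonpos.2 (sq_nonneg x)) (by linarith)
  have hcont : ContinuousAt g 1 := by
    have hden : 1 + 4 * |y| * 1 ≠ 0 := by positivity
    have hsqrt : Real.sqrt (1 + 4 * |y| * 1) ≠ 0 := by positivity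
    fun_prop (disch := assumption)
  rw [← Filter.tendsto_add_atTop_iff_nat 1]
  convert tendsto_gamma_average hmeas hbound hcont using 2 with n
  · simp [F, hg_def, Real.Gamma_nat_eq_factorial, mul_div_assoc]
  · simp [hg_def, div_eq_inv_mul]
end
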